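/- arXiv:math/0307236 — 2 statements merged into one kernel-verified Lean document; each statement's English description precedes it below -/
import Mathlib

section
/- Let P ⊆ ℤ_+^n be a discrete polymatroid whose set of bases B satisfies the strong exchange property. Then B is sortable: for all u, v ∈ B, the pair (u', v') defined by the conditions u' + v' = u + v and Σ_{j≤i} u'(j) = ⌈(Σ_{j≤i} (u(j)+v(j)))/2⌉ for every i ∈ [n] satisfies u' ∈ B and v' ∈ B. -/
/-- A discrete polymatroid on the ground set `[n]`. -/
def IsDiscretePolymatroid {n : ℕ} (P : Set (Fin n → ℕ)) : Prop :=
  P.Nonempty ∧ P.Finite ∧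
    (∀ u ∈ P, ∀ v : Fin n → ℕ, v ≤ u → v ∈ P) ∧
    (∀ u ∈ P, ∀ v ∈ P, ∑ i, u i < ∑ i, v i → ∃ w ∈ P, u < w ∧ w ≤ u ⊔ v)

/-- A base of `P` is a maximal element of `P`. -/
def IsBaseOf {n : ℕ} (P : Set (Fin n → ℕ)) (u : Fin n → ℕ) : Prop :=
  u ∈ P ∧ ∀ v ∈ P, u ≤ v → v = u

/-- `B` satisfies the strong exchange property. -/
def StrongExchange {n : ℕ} (B : Set (Fin n → ℕ)) : Prop :=
  ∀ u ∈ B, ∀ v ∈ B, u ≠ v → ∀ i j : Fin n, v i < u i → u j < v j →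
    u - Pi.single i 1 + Pi.single j 1 ∈ B

theorem sum_le_of_base {n : ℕ} {P : Set (Fin n → ℕ)} (hP : IsDiscretePolymatroid P)
    {u v : Fin n → ℕ} (hu : IsBaseOf P u) (hv : IsBaseOf P v) : ∑ i, v i ≤ ∑ i, u i := by
  by_contra! h
  obtain ⟨w, hw, h1, _⟩ := hP.2.2.2 u hu.1 v hv.1 h
  exact h1.ne (hu.2 w hw h1.le).symm

theorem mem_of_between {n : ℕ} {B : Set (Fin n → ℕ)} (hs : StrongExchange B)
    {v w : Fin n → ℕ} (hv : v ∈ B) (N : ℕ) : ∀ u ∈ B, ∑ i, (u i - w i) = N →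
    ∑ i, u i = ∑ i, w i → (∀ i, min (u i) (v i) ≤ w i ∧ w i ≤ max (u i) (v i)) → w ∈ B := by
  induction N with
  | zero =>
    intro u hu hN hsum _
    have hle : ∀ i ∈ Finset.univ, u i ≤ w i := by
      intro i hi
      have := (Finset.sum_eq_zero_iff.1 hN) i hi
      omega
    have : u = w := by
      funext i
      exact (Finset.sum_eq_sum_iff_of_le hle).1 hsum i (Finset.mem_univ i)
    exact this ▸ hu
  | succ N ih =>
    intro u hu hN hsum hb
    have hi : ∃ i, w i < u i := by
      by_contra! h
      have : ∑ i, (u i - w i) = 0 := Finset.sum_eq_zero (fun i _ => by have := h i; omega)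
      omega
    obtain ⟨i, hi⟩ := hi
    have hj : ∃ j, u j < w j := by
      by_contra! h
      have := Finset.sum_lt_sum (fun k (_ : k ∈ Finset.univ) => h k) ⟨i, Finset.mem_univ i, hi⟩
      omega
    obtain ⟨j, hj⟩ := hj
    have hij : i ≠ j := by rintro rfl; omega
    have hvi : v i < u i := by have := hb i; omega
    have hvj : u j < v j := by have := hb j; omega
    have hx := hs u hu v hv (by rintro rfl; omega) i j hvi hvj
    set x := u - Pi.single i 1 + Pi.single j 1 with hxdef
    have hxk : ∀ k, x k = u k - (if k = i then 1 else 0) + (if k = j then 1 else 0) := by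
      intro k; simp [hxdef, Pi.single_apply]
    refine ih x hx ?_ ?_ ?_
    · have h1 : ∑ k, (u k - w k) = ∑ k, ((x k - w k) + (if k = i then 1 else 0)) := by
        refine Finset.sum_congr rfl fun k _ => ?_
        rw [hxk]
        split_ifs <;> subst_vars <;> omega
      rw [Finset.sum_add_distrib] at h1
      simp at h1
      omega
    · have h1 : ∑ k, (x k + (if k = i then 1 else 0)) = ∑ k, (u k + (if k = j then 1 else 0)) := by
        refine Finset.sum_congr rfl fun k _ => ?_
        rw [hxk]
        split_ifs <;> subst_vars <;> omega
      rw [Finset.sum_add_distrib, Finset.sum_add_distrib] at h1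
      simp at h1
      omega
    · intro k
      have := hb k
      rw [hxk]
      split_ifs <;> subst_vars <;> omega

theorem prefix_lt {n : ℕ} (a b : Fin n → ℕ)
    (h : ∀ i : Fin n, ∑ j ∈ Finset.univ.filter (· ≤ i), a j =
        ((∑ j ∈ Finset.univ.filter (· ≤ i), b j) + 1) / 2) (i : Fin n) :
    ∑ j ∈ Finset.univ.filter (· < i), a j =
        ((∑ j ∈ Finset.univ.filter (· < i), b j) + 1) / 2 := by
  obtain ⟨i, hi⟩ := i
  cases i with
  | zero =>
    have : (Finset.univ.filter (· < (⟨0, hi⟩ : Fin n))) = ∅ := by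
      ext k; simp [Fin.lt_def]
    rw [this]; simp
  | succ m =>
    have : (Finset.univ.filter (· < (⟨m + 1, hi⟩ : Fin n))) =
        Finset.univ.filter (· ≤ (⟨m, by omega⟩ : Fin n)) := by
      ext k; simp [Fin.lt_def, Fin.le_def, Nat.lt_succ_iff]
    rw [this]; exact h _

theorem prefix_succ {n : ℕ} (a : Fin n → ℕ) (i : Fin n) :
    ∑ j ∈ Finset.univ.filter (· ≤ i), a j = a i + ∑ j ∈ Finset.univ.filter (· < i), a j := by
  have : (Finset.univ.filter (· ≤ i)) = insert i (Finset.univ.filter (· < i)) := by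
    ext k; simp [le_iff_eq_or_lt]
  rw [this, Finset.sum_insert (by simp)]

/-- Theorem 5.3(b)(i): if the set of bases `B` of a discrete polymatroid
satisfies the strong exchange property, then `B` is sortable: for all
`u, v ∈ B`, the sorted pair `(u', v')`, characterised by `u' + v' = u + v`
and the prefix-sum conditions
`Σ_{j≤i} u'(j) = ⌈(Σ_{j≤i} (u(j)+v(j)))/2⌉` for all `i`, again lies in
`B × B`. -/
theorem sortable_of_strongExchange {n : ℕ} (P B : Set (Fin n → ℕ))
    (hP : IsDiscretePolymatroid P) (hB : ∀ u, u ∈ B ↔ IsBaseOf P u)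
    (hstrong : StrongExchange B) :
    ∀ u ∈ B, ∀ v ∈ B, ∀ u' v' : Fin n → ℕ,
      u' + v' = u + v →
      (∀ i : Fin n, ∑ j ∈ Finset.univ.filter (· ≤ i), u' j =
        ((∑ j ∈ Finset.univ.filter (· ≤ i), (u j + v j)) + 1) / 2) →
      u' ∈ B ∧ v' ∈ B := by
  intro u hu v hv u' v' hadd hpre
  have hsum : ∑ i, u i = ∑ i, v i :=
    le_antisymm (sum_le_of_base hP ((hB v).1 hv) ((hB u).1 hu))
      (sum_le_of_base hP ((hB u).1 hu) ((hB v).1 hv))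
  have hadd' : ∀ i, u' i + v' i = u i + v i := fun i => congrFun hadd i
  have hk : ∀ i, 2 * u' i ≤ u i + v i + 1 ∧ u i + v i ≤ 2 * u' i + 1 := by
    intro i
    have h1 := hpre i
    have h2 := prefix_lt u' (fun j => u j + v j) hpre i
    rw [prefix_succ, prefix_succ] at h1
    omega
  have hu' : ∑ i, u' i = (∑ i, (u i + v i) + 1) / 2 := by
    cases n with
    | zero => simp
    | succ m =>
      have := hpre (Fin.last m)
      simpa [Fin.le_last] using this
  have htot : ∑ i, u' i + ∑ i, v' i = ∑ i, u i + ∑ i, v i := by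
    rw [← Finset.sum_add_distrib, ← Finset.sum_add_distrib]
    exact Finset.sum_congr rfl fun i _ => hadd' i
  rw [Finset.sum_add_distrib] at hu'
  constructor
  · refine mem_of_between hstrong hv _ u hu rfl (by omega) fun i => ?_
    have := hk i
    omega
  · refine mem_of_between hstrong hv _ u hu rfl (by omega) fun i => ?_
    have := hk i
    have := hadd' i
    omega
end

section
/- Let K be a field, P ⊆ ℤ_+^n a discrete polymatroid, and B its set of bases. Let K[B] be the K-subalgebra of the polynomial ring K[t_1,…,t_n,s] generated by the monomials t^u s = t_1^{u(1)}⋯t_n^{u(n)} s for u ∈ B. Then the base ring K[B] is a normal domain, i.e., it is integrally closed in its field of fractions. -/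
/-- The base ring `K[B] = K[t^u s : u ∈ B]`, realised as the `K`-subalgebra
of the polynomial ring `K[t_1,…,t_n,s]` (`= MvPolynomial (Fin (n+1)) K`, with
`t_i = X i.castSucc` and `s = X (Fin.last n)`) generated by the monomials
`t^u s`, `u ∈ B`. -/
noncomputable def baseRing (K : Type*) [Field K] {n : ℕ}
    (B : Set (Fin n → ℕ)) : Subalgebra K (MvPolynomial (Fin (n + 1)) K) :=
  Algebra.adjoin K
    {f | ∃ u ∈ B, f = (∏ i : Fin n, MvPolynomial.X i.castSucc ^ u i) *
      MvPolynomial.X (Fin.last n)}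

/-! ### Combinatorics of discrete polymatroids -/

/-- One-step augmentation. -/
theorem DP.augment {n : ℕ} {P : Set (Fin n → ℕ)} (hP : IsDiscretePolymatroid P)
    {u v : Fin n → ℕ} (hu : u ∈ P) (hv : v ∈ P) (h : ∑ i, u i < ∑ i, v i) :
    ∃ j, u j < v j ∧ u + Pi.single j 1 ∈ P := by
  obtain ⟨-, -, hD1, hD2⟩ := hP
  obtain ⟨w, hw, huw, hwuv⟩ := hD2 u hu v hv h
  obtain ⟨hle, j, hj⟩ := Pi.lt_def.1 huw
  refine ⟨j, ?_, hD1 w hw _ ?_⟩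
  · have := hwuv j
    simp only [Pi.sup_apply] at this
    rcases le_total (u j) (v j) with h1 | h1
    · rw [sup_eq_right.2 h1] at this; omega
    · rw [sup_eq_left.2 h1] at this; omega
  · intro k
    by_cases hk : k = j
    · subst hk; simp; omega
    · simp [hk]; exact hle k

theorem DP.mk_of_augment {n : ℕ} {P : Set (Fin n → ℕ)} (h0 : P.Nonempty) (hf : P.Finite)
    (h1 : ∀ u ∈ P, ∀ v : Fin n → ℕ, v ≤ u → v ∈ P)
    (h2 : ∀ u ∈ P, ∀ v ∈ P, ∑ i, u i < ∑ i, v i → ∃ j, u j < v j ∧ u + Pi.single j 1 ∈ P) :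
    IsDiscretePolymatroid P := by
  refine ⟨h0, hf, h1, fun u hu v hv h => ?_⟩
  obtain ⟨j, hj, hw⟩ := h2 u hu v hv h
  refine ⟨_, hw, ?_, ?_⟩
  · refine Pi.lt_def.2 ⟨fun k => ?_, j, ?_⟩ <;> simp
  · intro k
    by_cases hk : k = j
    · subst hk; simp; omega
    · simp [hk]

theorem DP.sum_aux {n : ℕ} {P Q : Set (Fin n → ℕ)} (hP : IsDiscretePolymatroid P)
    (hQ : IsDiscretePolymatroid Q) {v1 v2 : Fin n → ℕ} (hv1 : v1 ∈ P) (hv2 : v2 ∈ Q) :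
    ∀ (N : ℕ) (u1 u2 : Fin n → ℕ), u1 ∈ P → u2 ∈ Q →
      ∑ i, (((u1 i : ℤ) - v1 i).natAbs + ((u2 i : ℤ) - v2 i).natAbs) < N →
      ∑ i, (u1 + u2) i < ∑ i, (v1 + v2) i →
      ∃ j, (u1 + u2) j < (v1 + v2) j ∧
        ∃ a ∈ P, ∃ b ∈ Q, a + b = u1 + u2 + Pi.single j 1 := by
  intro N
  induction N with
  | zero => intro u1 u2 _ _ h; omega
  | succ N ih =>
    intro u1 u2 hu1 hu2 hN hlt
    have hlt' := hlt
    simp only [Pi.add_apply, Finset.sum_add_distrib] at hlt'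
    rcases lt_or_ge (∑ i, u1 i) (∑ i, v1 i) with h | h
    · obtain ⟨j, hj, hjP⟩ := DP.augment hP hu1 hv1 h
      by_cases hc : u1 j + u2 j < v1 j + v2 j
      · exact ⟨j, hc, _, hjP, _, hu2, by abel⟩
      · have h2 : u2 - Pi.single j 1 ∈ Q := hQ.2.2.1 u2 hu2 _ (fun k => by simp)
        have he : (u1 + Pi.single j 1) + (u2 - Pi.single j 1) = u1 + u2 := by
          ext k
          by_cases hk : k = j
          · subst hk; simp; omega
          · simp [hk]
        have := ih _ _ hjP h2 (by
          refine lt_of_lt_of_le (Finset.sum_lt_sum (g := fun i =>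
            (((u1 i : ℤ) - v1 i).natAbs + ((u2 i : ℤ) - v2 i).natAbs)) ?_ ?_)
            (Nat.lt_succ_iff.1 hN)
          · intro k _
            by_cases hk : k = j
            · subst hk; simp; omega
            · simp [hk]
          · refine ⟨j, Finset.mem_univ _, ?_⟩
            simp; omega) (by rwa [he])
        rwa [he] at this
    · have h : ∑ i, u2 i < ∑ i, v2 i := by omega
      obtain ⟨j, hj, hjP⟩ := DP.augment hQ hu2 hv2 h
      by_cases hc : u1 j + u2 j < v1 j + v2 j
      · exact ⟨j, hc, _, hu1, _, hjP, by abel⟩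
      · have h2 : u1 - Pi.single j 1 ∈ P := hP.2.2.1 u1 hu1 _ (fun k => by simp)
        have he : (u1 - Pi.single j 1) + (u2 + Pi.single j 1) = u1 + u2 := by
          ext k
          by_cases hk : k = j
          · subst hk; simp; omega
          · simp [hk]
        have := ih _ _ h2 hjP (by
          refine lt_of_lt_of_le (Finset.sum_lt_sum (g := fun i =>
            (((u1 i : ℤ) - v1 i).natAbs + ((u2 i : ℤ) - v2 i).natAbs)) ?_ ?_)
            (Nat.lt_succ_iff.1 hN)
          · intro k _
            by_cases hk : k = j
            · subst hk; simp; omega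
            · simp [hk]
          · refine ⟨j, Finset.mem_univ _, ?_⟩
            simp; omega) (by rwa [he])
        rwa [he] at this

open Pointwise in
theorem DP.sum {n : ℕ} {P Q : Set (Fin n → ℕ)} (hP : IsDiscretePolymatroid P)
    (hQ : IsDiscretePolymatroid Q) : IsDiscretePolymatroid (P + Q) := by
  refine DP.mk_of_augment (hP.1.add hQ.1) (hP.2.1.add hQ.2.1) ?_ ?_
  · intro u hu v hv
    obtain ⟨a, ha, b, hb, rfl⟩ := Set.mem_add.1 hu
    refine Set.mem_add.2 ⟨v ⊓ a, hP.2.2.1 a ha _ inf_le_right, v - v ⊓ a,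
      hQ.2.2.1 b hb _ fun k => ?_, ?_⟩
    · have := hv k
      simp at this ⊢
      omega
    · ext k; simp
  · intro u hu v hv h
    obtain ⟨a, ha, b, hb, rfl⟩ := Set.mem_add.1 hu
    obtain ⟨c, hc, d, hd, rfl⟩ := Set.mem_add.1 hv
    obtain ⟨j, hj, x, hx, y, hy, he⟩ := DP.sum_aux hP hQ hc hd _ a b ha hb (Nat.lt_succ_self _) h
    exact ⟨j, hj, Set.mem_add.2 ⟨x, hx, y, hy, he⟩⟩

/-- The `m`-fold sum. -/
def DP.mfold {n : ℕ} (P : Set (Fin n → ℕ)) : ℕ → Set (Fin n → ℕ)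
  | 0 => {0}
  | m + 1 => {w | ∃ a ∈ P, ∃ b ∈ DP.mfold P m, a + b = w}

theorem DP.mfold_dp {n : ℕ} {P : Set (Fin n → ℕ)} (hP : IsDiscretePolymatroid P) (m : ℕ) :
    IsDiscretePolymatroid (DP.mfold P m) := by
  induction m with
  | zero =>
    refine DP.mk_of_augment ⟨0, rfl⟩ (Set.finite_singleton _) ?_ ?_
    · intro u hu v hv
      have hu' : u = 0 := hu
      subst hu'
      exact Set.mem_singleton_iff.2 (le_antisymm hv (zero_le))
    · intro u hu v hv h
      have hu' : u = 0 := hu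
      have hv' : v = 0 := hv
      subst hu' hv'
      simp at h
  | succ m ih => exact DP.sum hP ih

theorem DP.mfold_smul {n : ℕ} {P : Set (Fin n → ℕ)} {u : Fin n → ℕ} (hu : u ∈ P) (m : ℕ) :
    m • u ∈ DP.mfold P m := by
  induction m with
  | zero => simp [DP.mfold]
  | succ m ih => exact ⟨u, hu, _, ih, by rw [succ_nsmul]; abel⟩

/-- A maximal element of a down-closed interval of a discrete polymatroid is contained in
a tight set. -/
theorem DP.mem_of_rank {n : ℕ} {Q : Set (Fin n → ℕ)} (hQ : IsDiscretePolymatroid Q)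
    (w : Fin n → ℕ) (hw : ∀ A : Finset (Fin n), ∃ u ∈ Q, ∑ i ∈ A, w i ≤ ∑ i ∈ A, u i) :
    w ∈ Q := by
  classical
  have D1 := hQ.2.2.1
  have h0 : (0 : Fin n → ℕ) ∈ Q := by
    obtain ⟨x, hx⟩ := hQ.1
    exact D1 x hx 0 (fun _ => Nat.zero_le _)
  obtain ⟨v, hv⟩ : ∃ v, Maximal (fun v => v ∈ Q ∧ v ≤ w) v := by
    have hfin : {v | v ∈ Q ∧ v ≤ w}.Finite := hQ.2.1.subset fun x hx => hx.1
    exact hfin.exists_maximal ⟨0, h0, fun _ => Nat.zero_le _⟩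
  obtain ⟨⟨hvQ, hvw⟩, hmax⟩ := hv
  by_contra hwQ
  have hne : ∃ i, v i < w i := by
    by_contra hcon
    push Not at hcon
    exact hwQ (by rwa [le_antisymm hvw hcon] at hvQ)
  obtain ⟨i, hi⟩ := hne
  have hvi : v + Pi.single i 1 ∉ Q := by
    intro hcon
    have := hmax (y := v + Pi.single i 1) ⟨hcon, fun k => by
      by_cases hk : k = i
      · subst hk; simp; omega
      · simp [hk]; exact hvw k⟩ (fun k => by simp) i
    simp at this
  -- fundamental circuit
  let A : Finset (Fin n) := Finset.univ.filter fun j =>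
    j = i ∨ (1 ≤ v j ∧ v + Pi.single i 1 - Pi.single j 1 ∈ Q)
  have hiA : i ∈ A := by simp [A]
  obtain ⟨u, hu, hle⟩ := hw A
  have hlt : ∑ k ∈ A, v k < ∑ k ∈ A, u k :=
    lt_of_lt_of_le (Finset.sum_lt_sum (fun k _ => hvw k) ⟨i, hiA, hi⟩) hle
  let r : (Fin n → ℕ) → (Fin n → ℕ) := fun x k => if k ∈ A then x k else 0
  have hr : ∀ x, r x ≤ x := fun x k => by simp only [r]; split_ifs <;> simp
  have hrs : ∀ x, ∑ k, r x k = ∑ k ∈ A, x k := fun x => by simp [r, Finset.sum_ite_mem]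
  obtain ⟨j, hj, hjQ⟩ := DP.augment hQ (D1 v hvQ _ (hr v)) (D1 u hu _ (hr u))
    (by rw [hrs, hrs]; exact hlt)
  have hjA : j ∈ A := by
    by_contra hcon
    simp [r, hcon] at hj
  -- `v + e_j ∉ Q`
  have sumadd : ∀ (x : Fin n → ℕ) (k : Fin n),
      ∑ t, (x + Pi.single k 1 : Fin n → ℕ) t = ∑ t, x t + 1 := by
    intro x k
    simp [Finset.sum_add_distrib]
  have sumsub : ∀ (x : Fin n → ℕ) (k : Fin n), 1 ≤ x k →
      ∑ t, (x - Pi.single k 1 : Fin n → ℕ) t + 1 = ∑ t, x t := by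
    intro x k hk
    rw [← sumadd _ k]
    congr 1
    ext t
    by_cases ht : t = k
    · subst ht; simp; omega
    · simp [ht]
  have hjv : v + Pi.single j 1 ∉ Q := by
    intro hcon
    by_cases hji : j = i
    · subst hji; exact hvi hcon
    have hjA' : 1 ≤ v j ∧ v + Pi.single i 1 - Pi.single j 1 ∈ Q := by
      simpa [A, hji] using hjA
    obtain ⟨t, ht, htQ⟩ := DP.augment hQ hjA'.2 hcon (by
      have h1 := sumsub (v + Pi.single i 1) j (by simp; omega)
      have h2 := sumadd v i
      have h3 := sumadd v j
      omega)
    have htj : t = j := by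
      by_contra hne
      by_cases hti : t = i
      · subst hti; simp [hne] at ht
      · simp [hne, hti] at ht
    subst htj
    apply hvi
    convert htQ using 1
    ext k
    by_cases hk : k = t
    · subst hk; simp; omega
    · simp [hk]
  -- extend `r v + e_j` inside `v + e_j`
  obtain ⟨y, hy⟩ : ∃ y, Maximal (fun y => y ∈ Q ∧ r v + Pi.single j 1 ≤ y ∧
      y ≤ v + Pi.single j 1) y := by
    have hfin : {y | y ∈ Q ∧ r v + Pi.single j 1 ≤ y ∧ y ≤ v + Pi.single j 1}.Finite :=
      hQ.2.1.subset fun x hx => hx.1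
    exact hfin.exists_maximal ⟨_, hjQ, le_rfl, fun k => by have := hr v k; simp; exact this⟩
  obtain ⟨⟨hyQ, hyl, hyu⟩, hymax⟩ := hy
  have hysum : ∑ t, v t ≤ ∑ t, y t := by
    by_contra hcon
    obtain ⟨t, ht, htQ⟩ := DP.augment hQ hyQ hvQ (not_le.1 hcon)
    have := hymax (y := y + Pi.single t 1) ⟨htQ, fun k => (hyl k).trans (by simp), fun k => by
      have := hyu k
      by_cases hk : k = t
      · subst hk; simp; omega
      · simp [hk] at this ⊢; exact this⟩ (fun k => by simp) t
    simp at this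
  have hyne : ∃ l, y l < (v + Pi.single j 1 : Fin n → ℕ) l := by
    by_contra hcon
    push Not at hcon
    exact hjv (by rwa [le_antisymm hyu hcon] at hyQ)
  obtain ⟨l, hl⟩ := hyne
  have hlA : l ∉ A := by
    intro hcon
    have := hyl l
    simp [r, hcon] at this hl
    omega
  have hlj : l ≠ j := fun h => hlA (h ▸ hjA)
  have hli : l ≠ i := fun h => hlA (h ▸ hiA)
  have hvl : 1 ≤ v l := by
    simp [hlj] at hl; omega
  -- `y ≤ v + e_j - e_l`, with equal sums
  have hye : y = v + Pi.single j 1 - Pi.single l 1 := by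
    have hle' : ∀ k ∈ Finset.univ, y k ≤ (v + Pi.single j 1 - Pi.single l 1 : Fin n → ℕ) k := by
      intro k _
      have := hyu k
      by_cases hk : k = l
      · subst hk; simp [hlj] at hl ⊢; omega
      · simpa [hk] using this
    have hs : ∑ k, y k = ∑ k, (v + Pi.single j 1 - Pi.single l 1 : Fin n → ℕ) k := by
      apply le_antisymm (Finset.sum_le_sum hle')
      have h1 := sumsub (v + Pi.single j 1) l (by simp; omega)
      have h2 := sumadd v j
      omega
    ext k
    exact (Finset.sum_eq_sum_iff_of_le hle').1 hs k (Finset.mem_univ _)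
  have hlQ : v + Pi.single i 1 - Pi.single l 1 ∉ Q := by
    intro hcon
    exact hlA (by simp [A, hvl, hcon])
  by_cases hji : j = i
  · subst hji; exact hlQ (hye ▸ hyQ)
  have hjA' : 1 ≤ v j ∧ v + Pi.single i 1 - Pi.single j 1 ∈ Q := by
    simpa [A, hji] using hjA
  have hx : v + Pi.single i 1 - Pi.single j 1 - Pi.single l 1 ∈ Q :=
    D1 _ hjA'.2 _ (fun k => by simp)
  obtain ⟨t, ht, htQ⟩ := DP.augment hQ hx hyQ (by
    have h1 := sumsub (v + Pi.single i 1) j (by simp; omega)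
    have h2 := sumsub (v + Pi.single i 1 - Pi.single j 1) l (by simp [hlj]; omega)
    have h3 := sumadd v i
    omega)
  rw [hye] at ht
  have htj : t = j := by
    by_contra hne
    by_cases hti : t = i
    · subst hti; simp [hne, Ne.symm hli] at ht
    · simp [hne, hti] at ht
  subst htj
  apply hlQ
  convert htQ using 1
  ext k
  by_cases hk : k = t
  · subst hk; simp [Ne.symm hlj, hji]; omega
  · simp [hk]

/-! ### Half-space subalgebras -/

open MvPolynomial in
/-- The polynomials all of whose exponents have weight at most `M`. -/
def WtLE {σ K : Type*} [Field K] (l : σ → ℤ) (M : ℤ) (f : MvPolynomial σ K) : Prop :=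
  ∀ w ∈ f.support, Finsupp.weight l w ≤ M

namespace WtLE

variable {σ K : Type*} [Field K] {l : σ → ℤ}

theorem mono {M N : ℤ} (h : M ≤ N) {f : MvPolynomial σ K} (hf : WtLE l M f) : WtLE l N f :=
  fun w hw => (hf w hw).trans h

theorem zero (M : ℤ) : WtLE l M (0 : MvPolynomial σ K) := by
  intro w hw; simp at hw

theorem add {M : ℤ} {f g : MvPolynomial σ K} (hf : WtLE l M f) (hg : WtLE l M g) :
    WtLE l M (f + g) := by
  classical
  intro w hw
  rcases Finset.mem_union.1 (MvPolynomial.support_add hw) with h | h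
  · exact hf w h
  · exact hg w h

theorem neg {M : ℤ} {f : MvPolynomial σ K} (hf : WtLE l M f) : WtLE l M (-f) := by
  intro w hw
  rw [MvPolynomial.support_neg] at hw
  exact hf w hw

theorem sub {M : ℤ} {f g : MvPolynomial σ K} (hf : WtLE l M f) (hg : WtLE l M g) :
    WtLE l M (f - g) := by
  rw [sub_eq_add_neg]; exact hf.add hg.neg

theorem mul {M N : ℤ} {f g : MvPolynomial σ K} (hf : WtLE l M f) (hg : WtLE l N g) :
    WtLE l (M + N) (f * g) := by
  classical
  intro w hw
  obtain ⟨a, ha, b, hb, rfl⟩ := Finset.mem_add.1 (MvPolynomial.support_mul f g hw)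
  rw [map_add]
  exact add_le_add (hf a ha) (hg b hb)

theorem const (c : K) : WtLE l 0 (MvPolynomial.C c : MvPolynomial σ K) := by
  classical
  intro w hw
  rw [MvPolynomial.mem_support_iff, MvPolynomial.coeff_C] at hw
  have : (0 : σ →₀ ℕ) = w := by
    by_contra h
    simp [h] at hw
  subst this
  simp

theorem pow {M : ℤ} {f : MvPolynomial σ K} (hf : WtLE l M f) (k : ℕ) :
    WtLE l (k * M) (f ^ k) := by
  induction k with
  | zero => simpa using const (l := l) (1 : K)
  | succ k ih =>
    rw [pow_succ]
    refine (ih.mul hf).mono ?_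
    push_cast; linarith

theorem sum {ι : Type*} (s : Finset ι) {M : ℤ} {f : ι → MvPolynomial σ K}
    (h : ∀ i ∈ s, WtLE l M (f i)) : WtLE l M (∑ i ∈ s, f i) := by
  classical
  induction s using Finset.induction_on with
  | empty => simpa using zero M
  | insert a s ha ih =>
    rw [Finset.sum_insert ha]
    exact (h a (by simp)).add (ih fun i hi => h i (by simp [hi]))

/-- Multiplicativity of the leading weight for powers. -/
theorem of_pow {M : ℤ} {f : MvPolynomial σ K} (hf : WtLE l M f) (N : ℕ)
    (h : WtLE l (N * M - 1) (f ^ N)) : WtLE l (M - 1) f := by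
  classical
  set g := MvPolynomial.weightedHomogeneousComponent l M f with hg
  have hgh : MvPolynomial.IsWeightedHomogeneous l g M :=
    MvPolynomial.weightedHomogeneousComponent_isWeightedHomogeneous M f
  have hgM : WtLE l M g := fun w hw => (hgh (MvPolynomial.mem_support_iff.1 hw)).le
  have hd : WtLE l (M - 1) (f - g) := by
    intro w hw
    rw [MvPolynomial.mem_support_iff, MvPolynomial.coeff_sub, hg,
      MvPolynomial.coeff_weightedHomogeneousComponent] at hw
    split_ifs at hw with h1
    · simp at hw
    · rw [sub_zero] at hw
      have := hf w (MvPolynomial.mem_support_iff.2 hw)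
      omega
  have key : ∀ k : ℕ, WtLE l (k * M - 1) (f ^ k - g ^ k) := by
    intro k
    induction k with
    | zero => simpa using zero _
    | succ k ih =>
      have : f ^ (k + 1) - g ^ (k + 1) = (f ^ k - g ^ k) * f + g ^ k * (f - g) := by ring
      rw [this]
      refine ((ih.mul hf).mono ?_).add (((hgM.pow k).mul hd).mono ?_) <;> push_cast <;> linarith
  have h1 : WtLE l (N * M - 1) (g ^ N) := by
    have := h.sub (key N)
    simpa using this
  have h2 : g ^ N = 0 := by
    by_contra hne
    obtain ⟨w, hw⟩ := MvPolynomial.support_nonempty.2 hne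
    have h3 := h1 w hw
    have h4 := (hgh.pow N) (MvPolynomial.mem_support_iff.1 hw)
    rw [h4] at h3
    simp at h3
  have h3 : g = 0 := by by_contra hne; exact pow_ne_zero N hne h2
  simpa [h3] using hd

end WtLE

/-- The half-space subalgebra. -/
def halfSub {σ : Type*} (K : Type*) [Field K] (l : σ → ℤ) : Subalgebra K (MvPolynomial σ K) where
  carrier := {f | WtLE l 0 f}
  mul_mem' := fun ha hb => by simpa using WtLE.mul ha hb
  add_mem' := fun ha hb => WtLE.add ha hb
  algebraMap_mem' := fun c => WtLE.const c

theorem halfSub_closed {σ K : Type*} [Field K] (l : σ → ℤ) (R : Subalgebra K (MvPolynomial σ K))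
    (hR : R ≤ halfSub K l) (f : MvPolynomial σ K) (hf : IsIntegral R f) : f ∈ halfSub K l := by
  classical
  change WtLE l 0 f
  -- some nonnegative upper bound
  obtain ⟨M, hM⟩ : ∃ M : ℕ, WtLE l M f := by
    refine ⟨(f.support.sup fun w => (Finsupp.weight l w).toNat), fun w hw => ?_⟩
    have : (Finsupp.weight l w).toNat ≤ f.support.sup fun w => (Finsupp.weight l w).toNat :=
      Finset.le_sup (f := fun w => (Finsupp.weight l w).toNat) hw
    omega
  induction M with
  | zero => simpa using hM
  | succ M ih =>
    apply ih
    obtain ⟨p, hp, he⟩ := hf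
    have h1 : f ^ p.natDegree = -∑ i ∈ Finset.range p.natDegree,
        ((p.coeff i : R) : MvPolynomial σ K) * f ^ i := by
      rw [Polynomial.eval₂_eq_sum_range, Finset.sum_range_succ, hp.coeff_natDegree] at he
      rw [map_one, one_mul] at he
      exact eq_neg_of_add_eq_zero_right he
    have h2 := WtLE.of_pow hM p.natDegree (by
      rw [h1]
      refine WtLE.neg (WtLE.sum _ fun i hi => ?_)
      have hc : WtLE l 0 ((p.coeff i : R) : MvPolynomial σ K) := hR (p.coeff i).2
      refine (hc.mul (hM.pow i)).mono ?_
      have hi' : (i : ℤ) + 1 ≤ p.natDegree := by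
        have := Finset.mem_range.1 hi
        omega
      push_cast
      nlinarith)
    exact h2.mono (by push_cast; linarith)

theorem closed_of_closedIn {σ K : Type*} [Field K] (R : Subalgebra K (MvPolynomial σ K))
    (h : ∀ f : MvPolynomial σ K, IsIntegral R f → f ∈ R) : IsIntegrallyClosed R := by
  let F := FractionRing (MvPolynomial σ K)
  have hinj : Function.Injective (algebraMap R F) := by
    rw [IsScalarTower.algebraMap_eq R (MvPolynomial σ K) F]
    exact (IsFractionRing.injective (MvPolynomial σ K) F).comp Subtype.val_injective
  have h1 : IsIntegrallyClosedIn R F := by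
    rw [isIntegrallyClosedIn_iff]
    refine ⟨hinj, fun {x} hx => ?_⟩
    have hx' : IsIntegral (MvPolynomial σ K) x := hx.tower_top
    obtain ⟨y, rfl⟩ := IsIntegrallyClosed.isIntegral_iff.1 hx'
    have hy : IsIntegral R y :=
      (isIntegral_algebraMap_iff (IsFractionRing.injective (MvPolynomial σ K) F)).1 hx
    exact ⟨⟨y, h y hy⟩, rfl⟩
  let φ : FractionRing R →ₐ[R] F := IsFractionRing.liftAlgHom (g := Algebra.ofId R F) hinj
  exact φ.isIntegrallyClosedIn φ.toRingHom.injective h1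

/-! ### The base ring -/

/-- The monomial `t^u s^m`. -/
noncomputable def tsMon (K : Type*) [Field K] {n : ℕ} (u : Fin n → ℕ) (m : ℕ) :
    MvPolynomial (Fin (n + 1)) K :=
  (∏ i : Fin n, MvPolynomial.X i.castSucc ^ u i) * MvPolynomial.X (Fin.last n) ^ m

theorem tsMon_add (K : Type*) [Field K] {n : ℕ} (u v : Fin n → ℕ) (m k : ℕ) :
    tsMon K (u + v) (m + k) = tsMon K u m * tsMon K v k := by
  simp only [tsMon, Pi.add_apply, pow_add, Finset.prod_mul_distrib]
  ring

theorem monomial_eq_tsMon (K : Type*) [Field K] {n : ℕ} (w : Fin (n + 1) →₀ ℕ) (c : K) :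
    MvPolynomial.monomial w c =
      MvPolynomial.C c * tsMon K (fun i : Fin n => w i.castSucc) (w (Fin.last n)) := by
  rw [MvPolynomial.monomial_eq, Finsupp.prod_fintype _ _ (by simp), Fin.prod_univ_castSucc, tsMon]

theorem weight_eq {n : ℕ} (l : Fin (n + 1) → ℤ) (w : Fin (n + 1) →₀ ℕ) :
    Finsupp.weight l w =
      ∑ i : Fin n, (w i.castSucc : ℤ) * l i.castSucc + (w (Fin.last n) : ℤ) * l (Fin.last n) := by
  rw [Finsupp.weight_apply, Finsupp.sum_fintype _ _ (by simp), Fin.sum_univ_castSucc]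
  simp

theorem tsMon_mem_halfSub (K : Type*) [Field K] {n : ℕ} (l : Fin (n + 1) → ℤ) (u : Fin n → ℕ)
    (h : ∑ i : Fin n, (u i : ℤ) * l i.castSucc + l (Fin.last n) ≤ 0) :
    tsMon K u 1 ∈ halfSub K l := by
  classical
  let w : Fin (n + 1) →₀ ℕ := Finsupp.equivFunOnFinite.symm (Fin.snoc (α := fun _ => ℕ) u 1)
  have hw1 : ∀ i : Fin n, w i.castSucc = u i := fun i => by simp [w]
  have hw2 : w (Fin.last n) = 1 := by simp [w]
  have h1 : tsMon K u 1 = MvPolynomial.monomial w 1 := by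
    rw [monomial_eq_tsMon, hw2]
    simp [hw1]
  rw [h1]
  intro x hx
  have hx' := MvPolynomial.support_monomial_subset hx
  rw [Finset.mem_singleton] at hx'
  subst hx'
  rw [weight_eq, hw2]
  simpa [hw1] using h

theorem mfold_sum_le {n : ℕ} {P : Set (Fin n → ℕ)} {d : ℕ} (hd : ∀ p ∈ P, ∑ i, p i ≤ d) (m : ℕ) :
    ∀ w ∈ DP.mfold P m, ∑ i, w i ≤ m * d := by
  induction m with
  | zero =>
    intro w hw
    have : w = 0 := hw
    simp [this]
  | succ m ih =>
    rintro w ⟨a, ha, b, hb, rfl⟩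
    have h1 := hd a ha
    have h2 := ih b hb
    simp only [Pi.add_apply, Finset.sum_add_distrib]
    nlinarith

theorem mfold_mem_baseRing (K : Type*) [Field K] {n : ℕ} {P B : Set (Fin n → ℕ)} {d : ℕ}
    (hd : ∀ p ∈ P, ∑ i, p i ≤ d) (hB : ∀ p ∈ P, d ≤ ∑ i, p i → p ∈ B) (m : ℕ) :
    ∀ w ∈ DP.mfold P m, m * d ≤ ∑ i, w i → tsMon K w m ∈ baseRing K B := by
  induction m with
  | zero =>
    intro w hw _
    have : w = 0 := hw
    subst this
    simp [tsMon, one_mem]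
  | succ m ih =>
    rintro w ⟨a, ha, b, hb, rfl⟩ hs
    have h1 := hd a ha
    have h2 := mfold_sum_le hd m b hb
    simp only [Pi.add_apply, Finset.sum_add_distrib] at hs
    rw [add_mul, one_mul] at hs
    rw [add_comm m 1, tsMon_add]
    refine mul_mem (Algebra.subset_adjoin ⟨a, hB a ha (by omega), ?_⟩) (ih b hb (by omega))
    simp [tsMon]

theorem baseRing_closedIn (K : Type*) [Field K] {n : ℕ}
    (P B : Set (Fin n → ℕ)) (hP : IsDiscretePolymatroid P)
    (hB : ∀ u, u ∈ B ↔ IsBaseOf P u) (f : MvPolynomial (Fin (n + 1)) K)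
    (hf : IsIntegral (baseRing K B) f) : f ∈ baseRing K B := by
  classical
  -- rank function
  have hrank : ∀ A : Finset (Fin n), ∃ u ∈ P, ∀ v ∈ P, ∑ i ∈ A, v i ≤ ∑ i ∈ A, u i := fun A =>
    Set.exists_max_image P (fun v => ∑ i ∈ A, v i) hP.2.1 hP.1
  choose ρ hρP hρ using hrank
  set d := ∑ i, ρ Finset.univ i with hd
  have hdle : ∀ p ∈ P, ∑ i, p i ≤ d := hρ Finset.univ
  have hbase : ∀ p ∈ P, d ≤ ∑ i, p i → p ∈ B := by
    intro p hp hdp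
    refine (hB p).2 ⟨hp, fun v hv hpv => ?_⟩
    have h1 : ∑ i, p i = ∑ i, v i :=
      le_antisymm (Finset.sum_le_sum fun i _ => hpv i) ((hdle v hv).trans hdp)
    ext i
    exact ((Finset.sum_eq_sum_iff_of_le fun i _ => hpv i).1 h1 i (Finset.mem_univ _)).symm
  have hbase' : ∀ u ∈ B, ∑ i, u i = d := by
    intro u hu
    obtain ⟨huP, hmax⟩ := (hB u).1 hu
    refine le_antisymm (hdle u huP) ?_
    by_contra hcon
    obtain ⟨j, -, hj⟩ := DP.augment hP huP (hρP Finset.univ) (not_le.1 hcon)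
    have := congrFun (hmax _ hj (fun k => by simp)) j
    simp at this
  let lA : Finset (Fin n) → Fin (n + 1) → ℤ := fun A =>
    Fin.snoc (α := fun _ => ℤ) (fun i => if i ∈ A then 1 else 0) (-(∑ i ∈ A, (ρ A i : ℤ)))
  let lB : Fin (n + 1) → ℤ := Fin.snoc (α := fun _ => ℤ) (fun _ => -1) (d : ℤ)
  have hfA : ∀ A, f ∈ halfSub K (lA A) := by
    intro A
    refine halfSub_closed _ _ (Algebra.adjoin_le ?_) f hf
    rintro g ⟨u, hu, rfl⟩
    have := tsMon_mem_halfSub K (lA A) u (by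
      have h1 := hρ A u ((hB u).1 hu).1
      zify at h1
      simp [lA]
      exact h1)
    simpa [tsMon] using this
  have hfB : f ∈ halfSub K lB := by
    refine halfSub_closed _ _ (Algebra.adjoin_le ?_) f hf
    rintro g ⟨u, hu, rfl⟩
    have := tsMon_mem_halfSub K lB u (by
      have h1 := hbase' u hu
      zify at h1
      simp [lB]
      exact h1.ge)
    simpa [tsMon] using this
  rw [f.as_sum]
  refine sum_mem fun w hw => ?_
  rw [monomial_eq_tsMon]
  refine mul_mem ((baseRing K B).algebraMap_mem _) ?_
  refine mfold_mem_baseRing K hdle hbase _ _ ?_ ?_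
  · refine DP.mem_of_rank (DP.mfold_dp hP _) _ fun A => ⟨_, DP.mfold_smul (hρP A) _, ?_⟩
    have h1 := hfA A w hw
    rw [weight_eq] at h1
    simp [lA] at h1
    zify
    simp only [Pi.smul_apply, smul_eq_mul, Nat.cast_mul, ← Finset.mul_sum]
    linarith
  · have h1 := hfB w hw
    rw [weight_eq] at h1
    simp [lB] at h1
    zify
    linarith

/-- Corollary 6.2: the base ring `K[B]` of a discrete polymatroid is a normal
domain, i.e. an integral domain that is integrally closed in its field of
fractions. -/
theorem baseRing_normal (K : Type*) [Field K] {n : ℕ}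
    (P B : Set (Fin n → ℕ)) (hP : IsDiscretePolymatroid P)
    (hB : ∀ u, u ∈ B ↔ IsBaseOf P u) :
    IsDomain (baseRing K B) ∧ IsIntegrallyClosed (baseRing K B) := by
  exact ⟨inferInstance, closed_of_closedIn _ (baseRing_closedIn K P B hP hB)⟩
end
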